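/- arXiv:2503.09825 — 2 statements merged into one kernel-verified Lean document; each statement's English description precedes it below -/
import Mathlib

section
/- Strict concavity of the mutual information in the input distribution: let κ be a Markov kernel from [0, A] to ℝ, and for a probability measure F on [0, A] set P_F = ∫ κ(x) dF(x) and I(F) = ∫ D_KL(κ(x) ‖ P_F) dF(x). Then for all probability measures F₁, F₂ on [0, A] and all t ∈ (0, 1), I(t·F₁ + (1−t)·F₂) ≥ t·I(F₁) + (1−t)·I(F₂); moreover, if I(F₁) and I(F₂) are finite and P_{F₁} ≠ P_{F₂}, the inequality is strict. -/
open MeasureTheory ProbabilityTheory Real ENNReal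

noncomputable section
open scoped Classical

/-- Kullback–Leibler divergence `D_KL(μ ‖ ν)` with values in `ℝ≥0∞`:
`∫ log (dμ/dν) dμ` when `μ ≪ ν` (and the log-likelihood ratio is integrable),
and `+∞` otherwise. -/
def klDiv' (μ ν : Measure ℝ) : ℝ≥0∞ :=
  if μ ≪ ν ∧ Integrable (llr μ ν) μ then ENNReal.ofReal (∫ y, llr μ ν y ∂μ) else ⊤

/-- Mutual information of a Markov kernel `κ` from `[0, A]` to `ℝ` at an input
distribution `F`: `I(F) = ∫ D_KL(κ(x) ‖ P_F) dF(x)` where `P_F = ∫ κ(x) dF(x)`. -/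
def kernelMutualInfo (A : ℝ) (κ : Kernel (Set.Icc (0 : ℝ) A) ℝ)
    (F : Measure (Set.Icc (0 : ℝ) A)) : ℝ≥0∞ :=
  ∫⁻ x, klDiv' (κ x) (F.bind (fun x => κ x)) ∂F

open InformationTheory

/-- Conditional KL divergence written as an integral. -/
lemma klDiv_compProd_right_eq_lintegral {X : Type*} [MeasurableSpace X]
    (μ : Measure X) [IsFiniteMeasure μ] (κ η : Kernel X ℝ) [IsMarkovKernel κ] [IsMarkovKernel η] :
    klDiv (μ ⊗ₘ κ) (μ ⊗ₘ η) = ∫⁻ x, klDiv (κ x) (η x) ∂μ := by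
  by_cases h : μ ⊗ₘ κ ≪ μ ⊗ₘ η
  · have h_ac : ∀ᵐ a ∂μ, κ a ≪ η a := h.kernel_of_compProd
    have hm : Measurable (fun p : X × ℝ => κ.rnDeriv η p.1 p.2) := Kernel.measurable_rnDeriv κ η
    have hκ : κ =ᵐ[μ] η.withDensity (κ.rnDeriv η) := by
      filter_upwards [h_ac] with a ha
      exact (Kernel.withDensity_rnDeriv_eq ha).symm
    have heq : μ ⊗ₘ κ = (μ ⊗ₘ η).withDensity (fun p => κ.rnDeriv η p.1 p.2) := by
      rw [Measure.compProd_congr hκ, Measure.compProd_withDensity hm]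
    have hrn : (μ ⊗ₘ κ).rnDeriv (μ ⊗ₘ η) =ᵐ[μ ⊗ₘ η] fun p => κ.rnDeriv η p.1 p.2 := by
      rw [heq]
      exact Measure.rnDeriv_withDensity _ hm
    rw [klDiv_eq_lintegral_klFun_of_ac h]
    have h1 : ∫⁻ p, ENNReal.ofReal (klFun ((μ ⊗ₘ κ).rnDeriv (μ ⊗ₘ η) p).toReal) ∂(μ ⊗ₘ η)
        = ∫⁻ p, ENNReal.ofReal (klFun (κ.rnDeriv η p.1 p.2).toReal) ∂(μ ⊗ₘ η) := by
      refine lintegral_congr_ae ?_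
      filter_upwards [hrn] with p hp using by simp only [hp]
    rw [h1, Measure.lintegral_compProd (by fun_prop)]
    refine lintegral_congr_ae ?_
    filter_upwards [h_ac] with a ha
    rw [klDiv_eq_lintegral_klFun_of_ac ha]
    refine lintegral_congr_ae ?_
    filter_upwards [Kernel.rnDeriv_eq_rnDeriv_measure (κ := κ) (η := η) (a := a)] with y hy
      using by simp only [hy]
  · rw [klDiv_of_not_ac h]
    rw [Measure.absolutelyContinuous_compProd_right_iff] at h
    symm
    have hS : MeasurableSet {a | κ a ≪ η a} := Kernel.measurableSet_absolutelyContinuous κ η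
    have hpos : μ {a | κ a ≪ η a}ᶜ ≠ 0 := fun h0 => h (by rw [ae_iff]; exact h0)
    rw [eq_top_iff]
    calc (⊤ : ℝ≥0∞) = ∫⁻ _ in {a | κ a ≪ η a}ᶜ, ⊤ ∂μ := by
          rw [setLIntegral_const, ENNReal.top_mul hpos]
      _ ≤ ∫⁻ x in {a | κ a ≪ η a}ᶜ, klDiv (κ x) (η x) ∂μ := by
          refine setLIntegral_mono' hS.compl fun x hx => ?_
          rw [klDiv_of_not_ac hx]
      _ ≤ _ := setLIntegral_le_lintegral _ _

lemma klDiv_map_swap {X Y : Type*} [MeasurableSpace X] [MeasurableSpace Y]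
    (μ ν : Measure (X × Y)) [IsFiniteMeasure μ] [IsFiniteMeasure ν] :
    klDiv (μ.map Prod.swap) (ν.map Prod.swap) = klDiv μ ν := by
  refine le_antisymm (klDiv_map_le _ _ measurable_swap) ?_
  have h := klDiv_map_le (μ := μ.map Prod.swap) (ν := ν.map Prod.swap)
    (measurable_swap (α := Y) (β := X))
  rw [Measure.map_map measurable_swap measurable_swap,
    Measure.map_map measurable_swap measurable_swap] at h
  simpa using h

lemma klDiv'_eq_klDiv (μ ν : Measure ℝ) [IsProbabilityMeasure μ] [IsProbabilityMeasure ν] :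
    klDiv' μ ν = klDiv μ ν := by
  rw [klDiv_def, klDiv']
  simp

/-- The golden formula (compensation identity). -/
lemma lintegral_klDiv_eq_add {X : Type*} [MeasurableSpace X] [StandardBorelSpace X] [Nonempty X]
    (κ : Kernel X ℝ) [IsMarkovKernel κ] (F : Measure X) [IsProbabilityMeasure F]
    (Q : Measure ℝ) [IsProbabilityMeasure Q] :
    ∫⁻ x, klDiv (κ x) Q ∂F = klDiv (κ ∘ₘ F) Q + ∫⁻ x, klDiv (κ x) (κ ∘ₘ F) ∂F := by
  have key : ∀ R : Measure ℝ, IsProbabilityMeasure R → ∫⁻ x, klDiv (κ x) R ∂F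
      = klDiv ((κ ∘ₘ F) ⊗ₘ κ†F) (R ⊗ₘ Kernel.const ℝ F) := by
    intro R hR
    have h := klDiv_compProd_right_eq_lintegral F κ (Kernel.const X R)
    simp only [Kernel.const_apply] at h
    rw [← h, ← klDiv_map_swap, compProd_posterior_eq_map_swap, Measure.compProd_const,
      Measure.compProd_const, Measure.prod_swap]
  rw [key Q inferInstance, key (κ ∘ₘ F) inferInstance, klDiv_compProd_eq_add]

/-- (strict) concavity of the mutual information in the input
distribution. For probability measures `F₁, F₂` on `[0, A]` and `t ∈ (0,1)`,
`I(t F₁ + (1−t) F₂) ≥ t I(F₁) + (1−t) I(F₂)`; if moreover `I(F₁), I(F₂)` are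
finite and `P_{F₁} ≠ P_{F₂}` then the inequality is strict. -/
theorem kernelMutualInfo_strictly_concave
    (A : ℝ) (hA : 0 < A)
    (κ : Kernel (Set.Icc (0 : ℝ) A) ℝ) [IsMarkovKernel κ]
    (F₁ F₂ : Measure (Set.Icc (0 : ℝ) A))
    [IsProbabilityMeasure F₁] [IsProbabilityMeasure F₂]
    (t : ℝ) (ht0 : 0 < t) (ht1 : t < 1) :
    ENNReal.ofReal t * kernelMutualInfo A κ F₁ +
        ENNReal.ofReal (1 - t) * kernelMutualInfo A κ F₂ ≤
      kernelMutualInfo A κ (ENNReal.ofReal t • F₁ + ENNReal.ofReal (1 - t) • F₂) ∧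
    (kernelMutualInfo A κ F₁ ≠ ⊤ → kernelMutualInfo A κ F₂ ≠ ⊤ →
      F₁.bind (fun x => κ x) ≠ F₂.bind (fun x => κ x) →
      ENNReal.ofReal t * kernelMutualInfo A κ F₁ +
          ENNReal.ofReal (1 - t) * kernelMutualInfo A κ F₂ <
        kernelMutualInfo A κ (ENNReal.ofReal t • F₁ + ENNReal.ofReal (1 - t) • F₂)) := by
  have : Nonempty (Set.Icc (0 : ℝ) A) := ⟨⟨0, le_refl _, hA.le⟩⟩
  set a := ENNReal.ofReal t with ha
  set b := ENNReal.ofReal (1 - t) with hb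
  have ha0 : a ≠ 0 := by simpa [ha] using ht0
  have hb0 : b ≠ 0 := by simpa [hb] using ht1
  have hat : a ≠ ⊤ := ENNReal.ofReal_ne_top
  have hbt : b ≠ ⊤ := ENNReal.ofReal_ne_top
  have hab : a + b = 1 := by
    rw [ha, hb, ← ENNReal.ofReal_add ht0.le (by linarith)]
    simp
  have hF : IsProbabilityMeasure (a • F₁ + b • F₂) := ⟨by simp [hab]⟩
  have hI : ∀ G : Measure (Set.Icc (0 : ℝ) A), IsProbabilityMeasure G →
      kernelMutualInfo A κ G = ∫⁻ x, klDiv (κ x) (κ ∘ₘ G) ∂G := by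
    intro G hG
    exact lintegral_congr fun x => klDiv'_eq_klDiv (κ x) (κ ∘ₘ G)
  have hmain : kernelMutualInfo A κ (a • F₁ + b • F₂) =
      (a * kernelMutualInfo A κ F₁ + b * kernelMutualInfo A κ F₂) +
      (a * klDiv (κ ∘ₘ F₁) (κ ∘ₘ (a • F₁ + b • F₂)) +
        b * klDiv (κ ∘ₘ F₂) (κ ∘ₘ (a • F₁ + b • F₂))) := by
    rw [hI _ hF, hI F₁ inferInstance, hI F₂ inferInstance]
    generalize hQ : κ ∘ₘ (a • F₁ + b • F₂) = Q
    have hQp : IsProbabilityMeasure Q := by rw [← hQ]; infer_instance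
    rw [lintegral_add_measure, lintegral_smul_measure, lintegral_smul_measure,
      lintegral_klDiv_eq_add κ F₁ Q, lintegral_klDiv_eq_add κ F₂ Q]
    simp only [smul_eq_mul]
    ring
  rw [hmain]
  refine ⟨le_self_add, fun h1 h2 hne => ?_⟩
  refine ENNReal.lt_add_right ?_ ?_
  · exact ENNReal.add_ne_top.mpr ⟨ENNReal.mul_ne_top hat h1, ENNReal.mul_ne_top hbt h2⟩
  · intro h0
    rw [add_eq_zero, mul_eq_zero, mul_eq_zero] at h0
    have e1 := klDiv_eq_zero_iff.mp (h0.1.resolve_left ha0)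
    have e2 := klDiv_eq_zero_iff.mp (h0.2.resolve_left hb0)
    exact hne (e1.trans e2.symm)
end
end

section
/- Weak continuity of the mutual information for the lognormal channel: if (Fₙ) is a sequence of probability measures on [0, A] converging weakly to a probability measure F, then I(Fₙ) → I(F), where I is the mutual information functional of the lognormal fading channel with additive Gaussian noise. -/
open MeasureTheory ProbabilityTheory Real ENNReal NNReal

noncomputable section
open scoped Classical

/-- The law `κ(x)` of the channel output `Y = K·x·e^{2G} + N`, where
`G ~ N(m, s²)` and `N ~ N(0, sg²)` are independent real Gaussians. -/
def channelLaw (K m s sg : ℝ) (x : ℝ) : Measure ℝ :=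
  Measure.map (fun p : ℝ × ℝ => K * x * Real.exp (2 * p.1) + p.2)
    ((gaussianReal m (Real.toNNReal (s ^ 2))).prod (gaussianReal 0 (Real.toNNReal (sg ^ 2))))

/-- The output distribution `P_F = ∫ κ(x) dF(x)`. -/
def outputDist (K m s sg : ℝ) (F : Measure ℝ) : Measure ℝ :=
  F.bind (channelLaw K m s sg)

/-- The marginal information density `i(x; F) = D_KL(κ(x) ‖ P_F)`. -/
def infoDensity (K m s sg : ℝ) (F : Measure ℝ) (x : ℝ) : ℝ≥0∞ :=
  klDiv' (channelLaw K m s sg x) (outputDist K m s sg F)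

/-- The mutual information `I(F) = ∫ i(x; F) dF(x) ∈ [0, ∞]`. -/
def mutualInfo (K m s sg : ℝ) (F : Measure ℝ) : ℝ≥0∞ :=
  ∫⁻ x, infoDensity K m s sg F x ∂F

/-- Membership in the feasible set `Ω`: `F` is a probability measure on `[0, A]`
with `∫ x dF ≤ ε` and `∫ b·x·ln(1 + c·x) dF ≥ E_th`. -/
def feasible (A ε b c Eth : ℝ) (F : Measure ℝ) : Prop :=
  IsProbabilityMeasure F ∧ F (Set.Icc 0 A)ᶜ = 0 ∧
    (∫ x, x ∂F) ≤ ε ∧ Eth ≤ ∫ x, b * x * Real.log (1 + c * x) ∂F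

/-- The capacity `C = sup_{F ∈ Ω} I(F)`. -/
def capacity (K m s sg A ε b c Eth : ℝ) : ℝ≥0∞ :=
  ⨆ F ∈ {F : Measure ℝ | feasible A ε b c Eth F}, mutualInfo K m s sg F


/-- The density of the channel law. -/
def chDens (K m s sg : ℝ) (x y : ℝ) : ℝ :=
  ∫ g, gaussianPDFReal (K * x * Real.exp (2 * g)) (Real.toNNReal (sg ^ 2)) y
    ∂(gaussianReal m (Real.toNNReal (s ^ 2)))

/-- Properties of a transition density used in the continuity proof. -/
structure GoodDens (A C : ℝ) (p : ℝ → ℝ → ℝ) : Prop where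
  meas : Measurable (Function.uncurry p)
  cont : ∀ y, Continuous (fun x => p x y)
  nonneg : ∀ x y, 0 ≤ p x y
  Cpos : 0 < C
  lo : ∀ x ∈ Set.Icc 0 A, ∀ y, Real.exp (-(C * (1 + y ^ 2))) ≤ p x y
  hi : ∀ x ∈ Set.Icc 0 A, ∀ y, p x y ≤ C * ((1 + y ^ 2) ^ 2)⁻¹

lemma gaussPDF_le_const (z : ℝ) (v : ℝ≥0) (y : ℝ) :
    gaussianPDFReal z v y ≤ (√(2 * π * v))⁻¹ := by
  rw [gaussianPDFReal]
  apply mul_le_of_le_one_right (by positivity)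
  apply Real.exp_le_one_iff.mpr
  rw [neg_div]
  have : 0 ≤ (y - z) ^ 2 / (2 * (v : ℝ)) := by positivity
  linarith

lemma gaussPDF_cont (v : ℝ≥0) :
    Continuous (fun q : ℝ × ℝ => gaussianPDFReal q.1 v q.2) := by
  unfold gaussianPDFReal
  fun_prop

lemma gaussPDF_integrable (K x y : ℝ) (v : ℝ≥0) (γ : Measure ℝ) [IsProbabilityMeasure γ] :
    Integrable (fun g => gaussianPDFReal (K * x * Real.exp (2 * g)) v y) γ := by
  refine Integrable.of_bound (C := (√(2 * π * v))⁻¹) ?_ (ae_of_all _ fun g => ?_)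
  · exact ((gaussPDF_cont v).comp (by fun_prop :
      Continuous fun g : ℝ => (K * x * Real.exp (2 * g), y))).aestronglyMeasurable
  · rw [Real.norm_of_nonneg (gaussianPDFReal_nonneg _ _ _)]
    exact gaussPDF_le_const _ _ _

lemma chDens_meas (K m s sg : ℝ) : Measurable (Function.uncurry (chDens K m s sg)) := by
  have h : StronglyMeasurable (fun q : (ℝ × ℝ) × ℝ =>
      gaussianPDFReal (K * q.1.1 * Real.exp (2 * q.2)) (Real.toNNReal (sg ^ 2)) q.1.2) :=
    ((gaussPDF_cont _).comp (by fun_prop : Continuous fun q : (ℝ × ℝ) × ℝ =>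
      (K * q.1.1 * Real.exp (2 * q.2), q.1.2))).stronglyMeasurable
  exact (h.integral_prod_right' (ν := gaussianReal m (Real.toNNReal (s ^ 2)))).measurable

lemma chDens_cont (K m s sg y : ℝ) : Continuous (fun x => chDens K m s sg x y) := by
  unfold chDens
  refine continuous_of_dominated (bound := fun _ => (√(2 * π * (Real.toNNReal (sg ^ 2))))⁻¹)
    ?_ ?_ ?_ ?_
  · intro x
    exact (gaussPDF_integrable _ _ _ _ _).aestronglyMeasurable
  · intro x
    refine ae_of_all _ fun g => ?_
    rw [Real.norm_of_nonneg (gaussianPDFReal_nonneg _ _ _)]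
    exact gaussPDF_le_const _ _ _
  · exact integrable_const _
  · refine ae_of_all _ fun g => ?_
    exact (gaussPDF_cont _).comp (by fun_prop : Continuous fun x : ℝ =>
      (K * x * Real.exp (2 * g), y))

lemma gaussPDF_lo (v : ℝ≥0) (hv : v ≠ 0) (z y w Z : ℝ) (hw : z ^ 2 ≤ w) :
    (√(2 * π * v))⁻¹ * (Real.exp (-((y ^ 2 + Z) / v)) * (1 + (Z - w) / v))
      ≤ gaussianPDFReal z v y := by
  have hv' : (0:ℝ) < v := by exact_mod_cast pos_iff_ne_zero.mpr hv
  rw [gaussianPDFReal]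
  gcongr
  have h1 : -((y ^ 2 + w) / v) ≤ -(y - z) ^ 2 / (2 * v) := by
    rw [neg_div, neg_le_neg_iff, div_le_div_iff₀ (by positivity) (by positivity)]
    nlinarith [sq_nonneg (y + z), mul_le_mul_of_nonneg_left hw hv'.le,
      mul_nonneg hv'.le (sq_nonneg (y + z))]
  refine le_trans ?_ (Real.exp_le_exp.mpr h1)
  have h2 : -((y ^ 2 + w) / (v:ℝ)) = -((y ^ 2 + Z) / v) + (Z - w) / v := by ring
  rw [h2, Real.exp_add]
  gcongr
  linarith [Real.add_one_le_exp ((Z - w) / (v:ℝ))]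

lemma gaussPDF_hi (v : ℝ≥0) (hv : v ≠ 0) (z y w : ℝ) (hw : z ^ 2 ≤ w) :
    gaussianPDFReal z v y ≤
      ((√(2 * π * v))⁻¹ * (32 * v ^ 2 * Real.exp (1 / (2 * v))) * (1 + w) ^ 2)
        * ((1 + y ^ 2) ^ 2)⁻¹ := by
  have hv' : (0:ℝ) < v := by exact_mod_cast pos_iff_ne_zero.mpr hv
  rw [gaussianPDFReal, ← div_eq_mul_inv, le_div_iff₀ (by positivity)]
  set u := y - z with hu
  have e1 : 1 + y ^ 2 ≤ 2 * (1 + u ^ 2) * (1 + w) := by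
    have : y = u + z := by ring
    rw [this]
    nlinarith [sq_nonneg (u - z), mul_nonneg (sq_nonneg u) (sq_nonneg z),
      mul_le_mul_of_nonneg_left hw (sq_nonneg u)]
  have e2 : (1 + y ^ 2) ^ 2 ≤ 4 * (1 + u ^ 2) ^ 2 * (1 + w) ^ 2 := by
    calc (1 + y ^ 2) ^ 2 ≤ (2 * (1 + u ^ 2) * (1 + w)) ^ 2 := by gcongr
      _ = _ := by ring
  have e3 : (1 + u ^ 2) ^ 2 ≤ 8 * v ^ 2 * Real.exp ((1 + u ^ 2) / (2 * v)) := by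
    have := Real.quadratic_le_exp_of_nonneg (x := (1 + u ^ 2) / (2 * (v:ℝ))) (by positivity)
    have h0 : 0 ≤ (1 + u ^ 2) / (2 * (v:ℝ)) := by positivity
    calc (1 + u ^ 2) ^ 2 = 8 * v ^ 2 * (((1 + u ^ 2) / (2 * (v:ℝ))) ^ 2 / 2) := by
          field_simp; ring
      _ ≤ _ := by gcongr; linarith
  have e4 : Real.exp (-u ^ 2 / (2 * v)) * (1 + u ^ 2) ^ 2 ≤ 8 * v ^ 2 * Real.exp (1 / (2 * v)) := by
    calc Real.exp (-u ^ 2 / (2 * v)) * (1 + u ^ 2) ^ 2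
        ≤ Real.exp (-u ^ 2 / (2 * v)) * (8 * v ^ 2 * Real.exp ((1 + u ^ 2) / (2 * v))) := by gcongr
      _ = 8 * v ^ 2 * (Real.exp (-u ^ 2 / (2 * v)) * Real.exp ((1 + u ^ 2) / (2 * v))) := by ring
      _ = _ := by rw [← Real.exp_add]; congr 2; ring
  calc (√(2 * π * v))⁻¹ * Real.exp (-u ^ 2 / (2 * v)) * (1 + y ^ 2) ^ 2
      ≤ (√(2 * π * v))⁻¹ * Real.exp (-u ^ 2 / (2 * v)) *
        (4 * (1 + u ^ 2) ^ 2 * (1 + w) ^ 2) := by gcongr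
    _ = (√(2 * π * v))⁻¹ * (4 * (Real.exp (-u ^ 2 / (2 * v)) * (1 + u ^ 2) ^ 2)) * (1 + w) ^ 2 := by
        ring
    _ ≤ (√(2 * π * v))⁻¹ * (4 * (8 * v ^ 2 * Real.exp (1 / (2 * v)))) * (1 + w) ^ 2 := by gcongr
    _ = _ := by ring

lemma chDens_good (K m s sg A : ℝ) (hK : 0 < K) (hsg : 0 < sg) :
    ∃ C, GoodDens A C (chDens K m s sg) := by
  set v : ℝ≥0 := Real.toNNReal (sg ^ 2) with hvdef
  have hv : v ≠ 0 := by
    rw [hvdef, Ne, Real.toNNReal_eq_zero]; push Not; positivity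
  have hv' : (0:ℝ) < v := by exact_mod_cast pos_iff_ne_zero.mpr hv
  set γ := gaussianReal m (Real.toNNReal (s ^ 2)) with hγ
  set w : ℝ → ℝ := fun g => (K * A) ^ 2 * Real.exp (4 * g) with hwdef
  have hwi : Integrable w γ := (integrable_exp_mul_gaussianReal 4).const_mul _
  have hw2 : Integrable (fun g => (1 + w g) ^ 2) γ := by
    have : (fun g => (1 + w g) ^ 2) = fun g => 1 + 2 * w g +
        (K * A) ^ 4 * Real.exp (8 * g) := by
      funext g
      have : Real.exp (8 * g) = Real.exp (4 * g) * Real.exp (4 * g) := by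
        rw [← Real.exp_add]; ring_nf
      rw [this, hwdef]; ring
    rw [this]
    exact ((integrable_const _).add (hwi.const_mul _)).add
      ((integrable_exp_mul_gaussianReal 8).const_mul _)
  have hwz : ∀ x ∈ Set.Icc 0 A, ∀ g, (K * x * Real.exp (2 * g)) ^ 2 ≤ w g := by
    intro x hx g
    have : Real.exp (4 * g) = Real.exp (2 * g) ^ 2 := by
      rw [← Real.exp_nat_mul]; push_cast; ring_nf
    simp only [hwdef, this]
    rw [← mul_pow]
    have := hx.1
    have := hx.2
    gcongr
  set Z := ∫ g, w g ∂γ with hZ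
  have hZ0 : 0 ≤ Z := integral_nonneg fun g => by positivity
  set W := ∫ g, (1 + w g) ^ 2 ∂γ with hW
  have hW0 : 0 ≤ W := integral_nonneg fun g => by positivity
  set r : ℝ := (√(2 * π * v))⁻¹ with hr
  have hr0 : 0 < r := by positivity
  set D := r * (32 * v ^ 2 * Real.exp (1 / (2 * v))) * W with hD
  have hD0 : 0 ≤ D := by positivity
  refine ⟨D + 1 / v + Z / v + |Real.log r| + 1, chDens_meas _ _ _ _, chDens_cont _ _ _ _, ?_, ?_, ?_, ?_⟩
  · intro x y
    exact integral_nonneg fun g => gaussianPDFReal_nonneg _ _ _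
  · positivity
  · intro x hx y
    have h1 : ∫ g, r * (Real.exp (-((y ^ 2 + Z) / v)) * (1 + (Z - w g) / v)) ∂γ
        ≤ chDens K m s sg x y := by
      refine integral_mono ?_ (gaussPDF_integrable _ _ _ _ _) fun g => ?_
      · exact (((integrable_const _).add (((integrable_const _).sub hwi).div_const _)).const_mul
          _).const_mul _
      · exact gaussPDF_lo v hv _ y _ Z (hwz x hx g)
    have h2 : ∫ g, r * (Real.exp (-((y ^ 2 + Z) / v)) * (1 + (Z - w g) / v)) ∂γ
        = r * Real.exp (-((y ^ 2 + Z) / v)) := by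
      have hs : Integrable (fun g => Z - w g) γ := (integrable_const _).sub hwi
      rw [integral_const_mul, integral_const_mul,
        integral_add (integrable_const _) (hs.div_const _),
        integral_div, integral_sub (integrable_const _) hwi, ← hZ]
      simp
    rw [h2] at h1
    refine le_trans ?_ h1
    rw [← Real.exp_log hr0, ← Real.exp_add, Real.log_exp]
    apply Real.exp_le_exp.mpr
    have a1 : (y ^ 2 + Z) / (v:ℝ) = 1 / v * y ^ 2 + Z / v := by ring
    have a2 := neg_abs_le (Real.log r)
    have a3 : 0 ≤ (D + Z / v + |Real.log r| + 1) * y ^ 2 := by positivity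
    have a4 : 0 < 1 / (v : ℝ) := by positivity
    rw [a1]
    nlinarith
  · intro x hx y
    have h1 : chDens K m s sg x y ≤ ∫ g, (r * (32 * v ^ 2 * Real.exp (1 / (2 * v))) * (1 + w g) ^ 2)
        * ((1 + y ^ 2) ^ 2)⁻¹ ∂γ := by
      refine integral_mono (gaussPDF_integrable _ _ _ _ _) ?_ fun g => ?_
      · exact (hw2.const_mul _).mul_const _
      · exact gaussPDF_hi v hv _ y _ (hwz x hx g)
    rw [integral_mul_const, integral_const_mul, ← hW, ← hD] at h1
    refine h1.trans ?_
    gcongr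
    have : 0 ≤ 1 / (v:ℝ) + Z / v + |Real.log r| + 1 := by positivity
    linarith

lemma channelLaw_eq (K m s sg : ℝ) (hsg : 0 < sg) (x : ℝ) :
    channelLaw K m s sg x =
      volume.withDensity (fun y => ENNReal.ofReal (chDens K m s sg x y)) := by
  have hv : Real.toNNReal (sg ^ 2) ≠ 0 := by
    rw [Ne, Real.toNNReal_eq_zero]; push Not; positivity
  ext S hS
  rw [channelLaw, Measure.map_apply (by fun_prop) hS, Measure.prod_apply
    ((by fun_prop : Measurable fun p : ℝ × ℝ => K * x * Real.exp (2 * p.1) + p.2) hS),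
    withDensity_apply _ hS]
  have h1 : ∀ g : ℝ, (gaussianReal 0 (Real.toNNReal (sg ^ 2)))
      (Prod.mk g ⁻¹' ((fun p : ℝ × ℝ => K * x * Real.exp (2 * p.1) + p.2) ⁻¹' S)) =
      ∫⁻ y in S, gaussianPDF (K * x * Real.exp (2 * g)) (Real.toNNReal (sg ^ 2)) y := by
    intro g
    rw [← gaussianReal_apply _ hv]
    have := gaussianReal_map_const_add (μ := 0) (v := Real.toNNReal (sg ^ 2))
      (K * x * Real.exp (2 * g))
    rw [zero_add] at this
    rw [← this, Measure.map_apply (by fun_prop) hS]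
    rfl
  simp_rw [h1]
  rw [lintegral_lintegral_swap]
  · refine lintegral_congr fun y => ?_
    rw [chDens, ofReal_integral_eq_lintegral_ofReal (gaussPDF_integrable _ _ _ _ _)
      (ae_of_all _ fun g => gaussianPDFReal_nonneg _ _ _)]
    rfl
  · refine Measurable.aemeasurable ?_
    refine ENNReal.measurable_ofReal.comp ?_
    exact ((gaussPDF_cont _).comp (by fun_prop : Continuous fun q : ℝ × ℝ =>
      (K * x * Real.exp (2 * q.1), q.2))).measurable

/-- The output density. -/
def mixDens (p : ℝ → ℝ → ℝ) (F : Measure ℝ) (y : ℝ) : ℝ := ∫ x, p x y ∂F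

lemma abs_log_bd {C t y : ℝ} (hC : 0 < C) (hlo : Real.exp (-(C * (1 + y ^ 2))) ≤ t)
    (hhi : t ≤ C * ((1 + y ^ 2) ^ 2)⁻¹) : |Real.log t| ≤ C * (1 + y ^ 2) := by
  have ht : 0 < t := (Real.exp_pos _).trans_le hlo
  rw [abs_le]
  constructor
  · exact (Real.le_log_iff_exp_le ht).mpr hlo
  · rw [Real.log_le_iff_le_exp ht]
    have h1 : ((1 + y ^ 2) ^ 2)⁻¹ ≤ 1 := inv_le_one_of_one_le₀ (by nlinarith [sq_nonneg y])
    have h2 : C ≤ C * (1 + y ^ 2) := by nlinarith [mul_nonneg hC.le (sq_nonneg y)]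
    have h3 := Real.add_one_le_exp (C * (1 + y ^ 2))
    nlinarith

lemma mul_log_bd {C t u y : ℝ} (hC : 0 < C) (hu0 : 0 ≤ u) (hu : u ≤ C * ((1 + y ^ 2) ^ 2)⁻¹)
    (hlo : Real.exp (-(C * (1 + y ^ 2))) ≤ t)
    (hhi : t ≤ C * ((1 + y ^ 2) ^ 2)⁻¹) : ‖u * Real.log t‖ ≤ C ^ 2 * (1 + y ^ 2)⁻¹ := by
  rw [norm_mul, Real.norm_of_nonneg hu0, Real.norm_eq_abs]
  calc u * |Real.log t| ≤ (C * ((1 + y ^ 2) ^ 2)⁻¹) * (C * (1 + y ^ 2)) :=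
        mul_le_mul hu (abs_log_bd hC hlo hhi) (abs_nonneg _) (by positivity)
    _ = _ := by field_simp


lemma bd_int (C : ℝ) : Integrable (fun y : ℝ => C ^ 2 * (1 + y ^ 2)⁻¹) :=
  integrable_inv_one_add_sq.const_mul _

lemma ae_Icc {A : ℝ} {F : Measure ℝ} (hF : F (Set.Icc 0 A)ᶜ = 0) : ∀ᵐ x ∂F, x ∈ Set.Icc 0 A :=
  hF


lemma GoodDens.int_F {A C : ℝ} {p : ℝ → ℝ → ℝ} (hp : GoodDens A C p) {F : Measure ℝ} [IsProbabilityMeasure F] (hF : F (Set.Icc 0 A)ᶜ = 0) (y : ℝ) :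
    Integrable (fun x => p x y) F := by
  refine Integrable.of_bound (C := C * ((1 + y ^ 2) ^ 2)⁻¹)
    (hp.cont y).aestronglyMeasurable ?_
  filter_upwards [ae_Icc hF] with x hx
  rw [Real.norm_of_nonneg (hp.nonneg _ _)]
  exact hp.hi x hx y

lemma GoodDens.mix_lo {A C : ℝ} {p : ℝ → ℝ → ℝ} (hp : GoodDens A C p) {F : Measure ℝ} [IsProbabilityMeasure F] (hF : F (Set.Icc 0 A)ᶜ = 0) (y : ℝ) :
    Real.exp (-(C * (1 + y ^ 2))) ≤ mixDens p F y := by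
  have h : ∫ _, Real.exp (-(C * (1 + y ^ 2))) ∂F ≤ mixDens p F y := by
    refine integral_mono_ae (integrable_const _) (hp.int_F hF y) ?_
    filter_upwards [ae_Icc hF] with x hx
    exact hp.lo x hx y
  simpa using h

lemma GoodDens.mix_hi {A C : ℝ} {p : ℝ → ℝ → ℝ} (hp : GoodDens A C p) {F : Measure ℝ} [IsProbabilityMeasure F] (hF : F (Set.Icc 0 A)ᶜ = 0) (y : ℝ) :
    mixDens p F y ≤ C * ((1 + y ^ 2) ^ 2)⁻¹ := by
  have h : mixDens p F y ≤ ∫ _, C * ((1 + y ^ 2) ^ 2)⁻¹ ∂F := by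
    refine integral_mono_ae (hp.int_F hF y) (integrable_const _) ?_
    filter_upwards [ae_Icc hF] with x hx
    exact hp.hi x hx y
  simpa using h

lemma GoodDens.mix_pos {A C : ℝ} {p : ℝ → ℝ → ℝ} (hp : GoodDens A C p) {F : Measure ℝ} [IsProbabilityMeasure F] (hF : F (Set.Icc 0 A)ᶜ = 0) (y : ℝ) :
    0 < mixDens p F y := (Real.exp_pos _).trans_le (hp.mix_lo hF y)

lemma GoodDens.mix_meas {A C : ℝ} {p : ℝ → ℝ → ℝ} (hp : GoodDens A C p) (F : Measure ℝ) [IsProbabilityMeasure F] : Measurable (mixDens p F) := by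
  have h : StronglyMeasurable (Function.uncurry p) := hp.meas.stronglyMeasurable
  exact (h.integral_prod_left (μ := F)).measurable

lemma GoodDens.meas_right {A C : ℝ} {p : ℝ → ℝ → ℝ} (hp : GoodDens A C p) (x : ℝ) : Measurable (p x) :=
  hp.meas.comp measurable_prodMk_left

lemma GoodDens.int_self {A C : ℝ} {p : ℝ → ℝ → ℝ} (hp : GoodDens A C p) {x : ℝ} (hx : x ∈ Set.Icc 0 A) :
    Integrable (fun y => p x y * Real.log (p x y)) := by
  refine (bd_int C).mono' ?_ (ae_of_all _ fun y => ?_)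
  · have := hp.meas_right x
    exact (this.mul this.log).aestronglyMeasurable
  · exact mul_log_bd hp.Cpos (hp.nonneg _ _) (hp.hi x hx y) (hp.lo x hx y) (hp.hi x hx y)

lemma GoodDens.int_cross {A C : ℝ} {p : ℝ → ℝ → ℝ} (hp : GoodDens A C p) {F : Measure ℝ} [IsProbabilityMeasure F] (hF : F (Set.Icc 0 A)ᶜ = 0)
    {x : ℝ} (hx : x ∈ Set.Icc 0 A) :
    Integrable (fun y => p x y * Real.log (mixDens p F y)) := by
  refine (bd_int C).mono' ?_ (ae_of_all _ fun y => ?_)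
  · have := hp.meas_right x
    exact (this.mul (hp.mix_meas F).log).aestronglyMeasurable
  · exact mul_log_bd hp.Cpos (hp.nonneg _ _) (hp.hi x hx y) (hp.mix_lo hF y) (hp.mix_hi hF y)

lemma GoodDens.self_cont {A C : ℝ} {p : ℝ → ℝ → ℝ} (hp : GoodDens A C p) :
    ContinuousOn (fun x => ∫ y, p x y * Real.log (p x y)) (Set.Icc 0 A) := by
  refine continuousOn_of_dominated (bound := fun y => C ^ 2 * (1 + y ^ 2)⁻¹) ?_ ?_ (bd_int C) ?_
  · intro x hx
    exact (hp.int_self hx).aestronglyMeasurable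
  · intro x hx
    exact ae_of_all _ fun y =>
      mul_log_bd hp.Cpos (hp.nonneg _ _) (hp.hi x hx y) (hp.lo x hx y) (hp.hi x hx y)
  · refine ae_of_all _ fun y => ?_
    exact (Real.continuous_mul_log.comp (hp.cont y)).continuousOn

lemma GoodDens.int_prod {A C : ℝ} {p : ℝ → ℝ → ℝ} (hp : GoodDens A C p) {F : Measure ℝ} [IsProbabilityMeasure F] (hF : F (Set.Icc 0 A)ᶜ = 0) :
    Integrable (Function.uncurry fun x y => p x y * Real.log (mixDens p F y))
      (F.prod volume) := by
  have hb : Integrable (fun z : ℝ × ℝ => (1 : ℝ) * (C ^ 2 * (1 + z.2 ^ 2)⁻¹)) (F.prod volume) :=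
    (integrable_const (1 : ℝ)).mul_prod (bd_int C)
  refine hb.mono' ?_ ?_
  · exact (hp.meas.mul ((hp.mix_meas F).log.comp measurable_snd)).aestronglyMeasurable
  · have h1 : ∀ᵐ z ∂(F.prod (volume : Measure ℝ)), z.1 ∈ Set.Icc 0 A :=
      Measure.quasiMeasurePreserving_fst.ae (ae_Icc hF)
    filter_upwards [h1] with z hz
    rw [one_mul]
    exact mul_log_bd hp.Cpos (hp.nonneg _ _) (hp.hi _ hz _) (hp.mix_lo hF _) (hp.mix_hi hF _)

/-- Real-valued expression of the mutual information. -/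
lemma GoodDens.fubini {A C : ℝ} {p : ℝ → ℝ → ℝ} (hp : GoodDens A C p) {F : Measure ℝ} [IsProbabilityMeasure F] (hF : F (Set.Icc 0 A)ᶜ = 0) :
    Integrable (fun x => (∫ y, p x y * Real.log (p x y))
      - ∫ y, p x y * Real.log (mixDens p F y)) F ∧
    ∫ x, ((∫ y, p x y * Real.log (p x y)) - ∫ y, p x y * Real.log (mixDens p F y)) ∂F
      = (∫ x, (∫ y, p x y * Real.log (p x y)) ∂F)
        - ∫ y, mixDens p F y * Real.log (mixDens p F y) := by
  have i1 : Integrable (fun x => ∫ y, p x y * Real.log (p x y)) F := by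
    have hr : F.restrict (Set.Icc 0 A) = F := Measure.restrict_eq_self_of_ae_mem (ae_Icc hF)
    have := hp.self_cont.integrableOn_compact (μ := F) isCompact_Icc
    rwa [IntegrableOn, hr] at this
  have i2 : Integrable (fun x => ∫ y, p x y * Real.log (mixDens p F y)) F :=
    (hp.int_prod hF).integral_prod_left
  refine ⟨i1.sub i2, ?_⟩
  rw [integral_sub i1 i2, integral_integral_swap (hp.int_prod hF)]
  congr 1
  refine integral_congr_ae (ae_of_all _ fun y => ?_)
  exact integral_mul_const _ _

lemma GoodDens.tendsto {A C : ℝ} {p : ℝ → ℝ → ℝ} (hp : GoodDens A C p) {F : ℕ → Measure ℝ} {Flim : Measure ℝ}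
    (hFn : ∀ n, IsProbabilityMeasure (F n) ∧ (F n) (Set.Icc 0 A)ᶜ = 0)
    (hweak : ∀ g : ℝ → ℝ, ContinuousOn g (Set.Icc 0 A) →
      Filter.Tendsto (fun n => ∫ x, g x ∂(F n)) Filter.atTop
        (nhds (∫ x, g x ∂Flim))) :
    Filter.Tendsto (fun n => (∫ x, (∫ y, p x y * Real.log (p x y)) ∂(F n))
        - ∫ y, mixDens p (F n) y * Real.log (mixDens p (F n) y)) Filter.atTop
      (nhds ((∫ x, (∫ y, p x y * Real.log (p x y)) ∂Flim)
        - ∫ y, mixDens p Flim y * Real.log (mixDens p Flim y))) := by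
  refine (hweak _ hp.self_cont).sub ?_
  refine tendsto_integral_of_dominated_convergence (fun y => C ^ 2 * (1 + y ^ 2)⁻¹) ?_
    (bd_int C) ?_ ?_
  · intro n
    have := (hFn n).1
    exact ((hp.mix_meas (F n)).mul (hp.mix_meas (F n)).log).aestronglyMeasurable
  · intro n
    have := (hFn n).1
    have hF := (hFn n).2
    exact ae_of_all _ fun y => mul_log_bd hp.Cpos (hp.mix_pos hF y).le (hp.mix_hi hF y)
      (hp.mix_lo hF y) (hp.mix_hi hF y)
  · refine ae_of_all _ fun y => ?_
    exact (Real.continuous_mul_log.tendsto _).comp (hweak _ (hp.cont y).continuousOn)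

lemma GoodDens.kl {A C : ℝ} {p : ℝ → ℝ → ℝ} (hp : GoodDens A C p) {F : Measure ℝ} [IsProbabilityMeasure F] (hF : F (Set.Icc 0 A)ᶜ = 0)
    {x : ℝ} (hx : x ∈ Set.Icc 0 A) {μ ν : Measure ℝ}
    [IsProbabilityMeasure μ] [IsProbabilityMeasure ν]
    (hμ : μ = volume.withDensity (fun y => ENNReal.ofReal (p x y)))
    (hν : ν = volume.withDensity (fun y => ENNReal.ofReal (mixDens p F y))) :
    klDiv' μ ν = ENNReal.ofReal ((∫ y, p x y * Real.log (p x y))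
      - ∫ y, p x y * Real.log (mixDens p F y)) ∧
    0 ≤ (∫ y, p x y * Real.log (p x y))
      - ∫ y, p x y * Real.log (mixDens p F y) := by
  have hpm := hp.meas_right x
  have hqm := hp.mix_meas F
  have hpos : ∀ y, 0 < p x y := fun y => (Real.exp_pos _).trans_le (hp.lo x hx y)
  have hqpos := hp.mix_pos hF
  have hμν : μ = ν.withDensity (fun y => ENNReal.ofReal (p x y / mixDens p F y)) := by
    have hd : Measurable (fun y => ENNReal.ofReal (p x y / mixDens p F y)) :=
      (hpm.div hqm).ennreal_ofReal
    rw [hν, ← withDensity_mul _ hqm.ennreal_ofReal hd, hμ]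
    congr 1
    funext y
    simp only [Pi.mul_apply]
    rw [← ENNReal.ofReal_mul (hqpos y).le, mul_div_cancel₀ _ (hqpos y).ne']
  have hac : μ ≪ ν := by rw [hμν]; exact withDensity_absolutelyContinuous _ _
  have hrn : μ.rnDeriv ν =ᵐ[ν] fun y => ENNReal.ofReal (p x y / mixDens p F y) := by
    conv_lhs => rw [hμν]
    exact Measure.rnDeriv_withDensity _ (hpm.div hqm).ennreal_ofReal
  have hllr : llr μ ν =ᵐ[μ] fun y => Real.log (p x y) - Real.log (mixDens p F y) := by
    filter_upwards [hac.ae_le hrn] with y hy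
    rw [llr, hy, ENNReal.toReal_ofReal (div_pos (hpos y) (hqpos y)).le,
      Real.log_div (hpos y).ne' (hqpos y).ne']
  have hfun : (fun y => (ENNReal.ofReal (p x y)).toReal •
      (Real.log (p x y) - Real.log (mixDens p F y))) =
      fun y => p x y * Real.log (p x y) - p x y * Real.log (mixDens p F y) := by
    funext y
    rw [ENNReal.toReal_ofReal (hpos y).le, smul_eq_mul, mul_sub]
  have hint : Integrable (llr μ ν) μ := by
    rw [integrable_congr hllr, hμ, integrable_withDensity_iff_integrable_smul' hpm.ennreal_ofReal
      (ae_of_all _ fun y => ENNReal.ofReal_lt_top), hfun]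
    exact (hp.int_self hx).sub (hp.int_cross hF hx)
  have hval : ∫ y, llr μ ν y ∂μ = (∫ y, p x y * Real.log (p x y))
      - ∫ y, p x y * Real.log (mixDens p F y) := by
    rw [integral_congr_ae hllr]
    conv_lhs => rw [hμ]
    rw [integral_withDensity_eq_integral_toReal_smul hpm.ennreal_ofReal
      (ae_of_all _ fun y => ENNReal.ofReal_lt_top), hfun,
      integral_sub (hp.int_self hx) (hp.int_cross hF hx)]
  constructor
  · rw [klDiv', if_pos ⟨hac, hint⟩, hval]
  · have := InformationTheory.integral_llr_add_sub_measure_univ_nonneg hac hint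
    rw [hval] at this
    simpa using this


lemma channelLaw_prob (K m s sg x : ℝ) : IsProbabilityMeasure (channelLaw K m s sg x) := by
  unfold channelLaw
  exact Measure.isProbabilityMeasure_map (by fun_prop)

lemma channelLaw_measurable (K m s sg : ℝ) (hsg : 0 < sg) : Measurable (channelLaw K m s sg) := by
  refine Measure.measurable_of_measurable_coe _ fun S hS => ?_
  simp_rw [channelLaw_eq K m s sg hsg, withDensity_apply _ hS]
  exact (chDens_meas K m s sg).ennreal_ofReal.lintegral_prod_right'

lemma outputDist_prob (K m s sg : ℝ) (hsg : 0 < sg) (F : Measure ℝ) [IsProbabilityMeasure F] :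
    IsProbabilityMeasure (outputDist K m s sg F) := by
  constructor
  have := channelLaw_prob K m s sg
  rw [outputDist, Measure.bind_apply MeasurableSet.univ (channelLaw_measurable K m s sg hsg).aemeasurable]
  simp

lemma outputDist_eq {K m s sg A C : ℝ} (hsg : 0 < sg) (hp : GoodDens A C (chDens K m s sg))
    (F : Measure ℝ) [IsProbabilityMeasure F] (hF : F (Set.Icc 0 A)ᶜ = 0) :
    outputDist K m s sg F =
      volume.withDensity (fun y => ENNReal.ofReal (mixDens (chDens K m s sg) F y)) := by
  ext S hS
  rw [outputDist, Measure.bind_apply hS (channelLaw_measurable K m s sg hsg).aemeasurable,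
    withDensity_apply _ hS]
  simp_rw [channelLaw_eq K m s sg hsg, withDensity_apply _ hS]
  rw [lintegral_lintegral_swap]
  · refine lintegral_congr fun y => ?_
    rw [mixDens, ofReal_integral_eq_lintegral_ofReal (hp.int_F hF y)
      (ae_of_all _ fun x => hp.nonneg _ _)]
  · exact hp.meas.ennreal_ofReal.aemeasurable

lemma mutualInfo_eq {K m s sg A C : ℝ} (hsg : 0 < sg) (hp : GoodDens A C (chDens K m s sg))
    (F : Measure ℝ) [IsProbabilityMeasure F] (hF : F (Set.Icc 0 A)ᶜ = 0) :
    mutualInfo K m s sg F = ENNReal.ofReal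
      ((∫ x, (∫ y, chDens K m s sg x y * Real.log (chDens K m s sg x y)) ∂F)
        - ∫ y, mixDens (chDens K m s sg) F y * Real.log (mixDens (chDens K m s sg) F y)) := by
  have h1 := channelLaw_prob K m s sg
  have h2 := outputDist_prob K m s sg hsg F
  have hk := fun x (hx : x ∈ Set.Icc 0 A) =>
    hp.kl hF hx (channelLaw_eq K m s sg hsg x) (outputDist_eq hsg hp F hF)
  obtain ⟨hi, he⟩ := hp.fubini hF
  rw [← he, ofReal_integral_eq_lintegral_ofReal hi]
  · refine lintegral_congr_ae ?_
    filter_upwards [ae_Icc hF] with x hx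
    exact (hk x hx).1
  · filter_upwards [ae_Icc hF] with x hx
    exact (hk x hx).2

/-- weak continuity of the mutual information of the lognormal
channel. If probability measures `Fₙ` on `[0, A]` converge weakly to `F` (i.e.
`∫ g dFₙ → ∫ g dF` for every continuous `g` on `[0, A]`), then `I(Fₙ) → I(F)`. -/
theorem mutualInfo_weakly_continuous
    (K m s sg A : ℝ)
    (hK : 0 < K) (hs : 0 < s) (hsg : 0 < sg) (hA : 0 < A)
    (F : ℕ → Measure ℝ) (Flim : Measure ℝ)
    (hFn : ∀ n, IsProbabilityMeasure (F n) ∧ (F n) (Set.Icc 0 A)ᶜ = 0)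
    (hFlim : IsProbabilityMeasure Flim ∧ Flim (Set.Icc 0 A)ᶜ = 0)
    (hweak : ∀ g : ℝ → ℝ, ContinuousOn g (Set.Icc 0 A) →
      Filter.Tendsto (fun n => ∫ x, g x ∂(F n)) Filter.atTop
        (nhds (∫ x, g x ∂Flim))) :
    Filter.Tendsto (fun n => mutualInfo K m s sg (F n)) Filter.atTop
      (nhds (mutualInfo K m s sg Flim)) := by
  obtain ⟨C, hp⟩ := chDens_good K m s sg A hK hsg
  have e : ∀ n, _ := fun n =>
    have := (hFn n).1
    mutualInfo_eq hsg hp (F n) (hFn n).2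
  have := hFlim.1
  simp_rw [e, mutualInfo_eq hsg hp Flim hFlim.2]
  exact (ENNReal.continuous_ofReal.tendsto _).comp (hp.tendsto hFn hweak)
end
end
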